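/- Let Σ be an alphabet, let # be a symbol not in Σ, and let k ≥ 2. Suppose u = u_1 # u_2 # ⋯ u_k # where each u_i is a nonempty squarefree word over Σ. If u contains a factor of the form v^k with v nonempty, then v = a# for some word a over Σ, u_2 = u_3 = ⋯ = u_k = a, and a is a suffix of u_1. Consequently, if moreover u_1 = a, then u = (a#)^k is itself a k-power. -/

import Mathlib

/-- `wordPow v k` is the word `v` concatenated with itself `k` times, i.e. `v ^ k`. -/
def wordPow {α : Type*} (v : List α) (k : ℕ) : List α :=
  (List.replicate k v).flatten

/-- A word is squarefree if it has no factor of the form `x x` with `x` nonempty. -/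
def SqfWord {α : Type*} (w : List α) : Prop :=
  ¬ ∃ s t x : List α, x ≠ [] ∧ w = s ++ x ++ x ++ t

/-- The concatenation `u₁# u₂# ⋯ uₙ#` of the words `u₁, …, uₙ` in `L`, each followed by `#`. -/
def markedConcat {α : Type*} (hash : α) (L : List (List α)) : List α :=
  (L.map fun x => x ++ [hash]).flatten

theorem markedConcat_cons {α : Type*} (hash : α) (x : List α) (L : List (List α)) :
    markedConcat hash (x :: L) = x ++ hash :: markedConcat hash L := by
  simp [markedConcat]

/-- Marked concatenation is injective on lists of words not containing the marker. -/
theorem markedConcat_injOn {α : Type*} (hash : α) : ∀ {L M : List (List α)},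
    (∀ x ∈ L, hash ∉ x) → (∀ x ∈ M, hash ∉ x) →
    markedConcat hash L = markedConcat hash M → L = M
  | [], [], _, _, _ => rfl
  | [], y :: M, _, _, h => by simp [markedConcat] at h
  | x :: L, [], _, _, h => by simp [markedConcat] at h
  | x :: L, y :: M, hL, hM, h => by
    simp only [List.mem_cons, forall_eq_or_imp] at hL hM
    rw [markedConcat_cons, markedConcat_cons] at h
    have hxy : x = y ∧ markedConcat hash L = markedConcat hash M := by
      rcases List.append_eq_append_iff.1 h with ⟨c, rfl, hc⟩ | ⟨c, rfl, hc⟩ <;>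
        cases c <;> simp_all
    rw [hxy.1, markedConcat_injOn hash hL.2 hM.2 hxy.2]

/-- A nonempty marker-free factor of a marked concatenation is a factor of one of the words. -/
theorem exists_isInfix_of_isInfix_markedConcat {α : Type*} {hash : α} {w : List α}
    (hw : w ≠ []) (hhash : hash ∉ w) : ∀ {L : List (List α)},
    w <:+: markedConcat hash L → ∃ x ∈ L, w <:+: x
  | [], h => by simp [markedConcat, hw] at h
  | x :: L, ⟨s, t, h⟩ => by
    rw [markedConcat_cons] at h
    rcases List.append_eq_append_iff.1 h with ⟨c, hc, -⟩ | ⟨c, hc, hc'⟩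
    · exact ⟨x, by simp, s, c, hc.symm⟩
    · rcases List.append_eq_append_iff.1 hc with ⟨d, rfl, rfl⟩ | ⟨d, rfl, rfl⟩
      · cases c with
        | nil => exact ⟨_, List.mem_cons_self, s, [], by simp⟩
        | cons e c => simp_all
      · cases d with
        | nil => cases w <;> simp_all
        | cons e d =>
          obtain ⟨y, hy, hwy⟩ := exists_isInfix_of_isInfix_markedConcat hw hhash
            (L := L) ⟨d, t, (List.cons.inj hc').2.symm⟩
          exact ⟨y, List.mem_cons_of_mem _ hy, hwy⟩

theorem count_markedConcat {α : Type*} [DecidableEq α] {hash : α} : ∀ {L : List (List α)},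
    (∀ x ∈ L, hash ∉ x) → (markedConcat hash L).count hash = L.length
  | [], _ => by simp [markedConcat]
  | x :: L, h => by
    simp only [List.mem_cons, forall_eq_or_imp] at h
    simp [markedConcat_cons, count_markedConcat h.2, List.count_eq_zero_of_not_mem h.1]

theorem count_wordPow {α : Type*} [DecidableEq α] (c : α) (v : List α) (k : ℕ) :
    (wordPow v k).count c = k * v.count c := by
  simp [wordPow, List.count_flatten]

theorem wordPow_succ {α : Type*} (v : List α) (k : ℕ) :
    wordPow v (k + 1) = v ++ wordPow v k := by
  simp [wordPow, List.replicate_succ]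

theorem wordPow_succ_right {α : Type*} (v : List α) (k : ℕ) :
    wordPow v (k + 1) = wordPow v k ++ v := by
  simp [wordPow, List.replicate_succ']

theorem wordPow_append_singleton {α : Type*} (hash : α) (a : List α) (k : ℕ) :
    wordPow (a ++ [hash]) k = markedConcat hash (List.replicate k a) := by
  simp [wordPow, markedConcat]

/-- A nonempty marked concatenation ends with the marker. -/
theorem getLast?_markedConcat {α : Type*} (hash : α) {L : List (List α)} (hL : L ≠ []) :
    (markedConcat hash L).getLast? = some hash := by
  rw [← List.dropLast_append_getLast hL]
  simp [markedConcat]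

/-- Let `u = u₁# u₂# ⋯ u_k#` where `k ≥ 2`, each `u_i` is a nonempty squarefree word
not containing `#`.  If `u` has a factor `v^k` with `v` nonempty, then `v = a#` for
some `#`-free word `a`, `u₂ = ⋯ = u_k = a`, and `a` is a suffix of `u₁`; consequently,
if moreover `u₁ = a`, then `u = (a#)^k` is itself a `k`-power. -/
theorem kpower_factor_in_marked_squarefree_concat {α : Type*} (hash : α)
    (k : ℕ) (hk : 2 ≤ k) (u : Fin k → List α)
    (hne : ∀ i, u i ≠ []) (hhash : ∀ i, hash ∉ u i) (hsf : ∀ i, SqfWord (u i))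
    (v s t : List α) (hv : v ≠ [])
    (hfac : (List.ofFn fun i => u i ++ [hash]).flatten = s ++ wordPow v k ++ t) :
    ∃ a : List α, hash ∉ a ∧ v = a ++ [hash] ∧
      (∀ i : Fin k, 1 ≤ (i : ℕ) → u i = a) ∧
      a <:+ u ⟨0, by omega⟩ ∧
      (u ⟨0, by omega⟩ = a →
        (List.ofFn fun i => u i ++ [hash]).flatten = wordPow (a ++ [hash]) k) := by
  classical
  obtain ⟨n, rfl⟩ : ∃ n, k = n + 2 := ⟨k - 2, by omega⟩
  have hofn : (List.ofFn fun i => u i ++ [hash]).flatten = markedConcat hash (List.ofFn u) := by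
    simp [markedConcat, List.map_ofFn, Function.comp_def]
  have hfree : ∀ x ∈ List.ofFn u, hash ∉ x := by
    intro x hx
    obtain ⟨i, rfl⟩ := (List.mem_ofFn' _ _).1 hx
    exact hhash i
  rw [hofn] at hfac ⊢
  have hmem : hash ∈ v := by
    by_contra hnot
    obtain ⟨x, hx, p, q, hpq⟩ :=
      exists_isInfix_of_isInfix_markedConcat (hash := hash) (w := v ++ v)
        (by simp [hv]) (by simp [hnot])
        (L := List.ofFn u) ⟨s, wordPow v n ++ t, by rw [hfac]; simp [wordPow_succ]⟩
    obtain ⟨i, rfl⟩ := (List.mem_ofFn' _ _).1 hx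
    exact hsf i ⟨p, q, v, hv, by simp [← hpq]⟩
  have hcount := congrArg (List.count hash) hfac
  rw [count_markedConcat hfree, List.length_ofFn, List.count_append, List.count_append,
    count_wordPow] at hcount
  have hpos := List.count_pos_iff.2 hmem
  have hone : v.count hash = 1 := by nlinarith
  rw [hone] at hcount
  have hs : hash ∉ s := List.count_eq_zero.1 (by omega)
  have ht : hash ∉ t := List.count_eq_zero.1 (by omega)
  obtain ⟨a, b, rfl⟩ := List.append_of_mem hmem
  simp only [List.count_append, List.count_cons_self] at hone
  have ha : hash ∉ a := List.count_eq_zero.1 (by omega)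
  have hb : hash ∉ b := List.count_eq_zero.1 (by omega)
  have hbt : b ++ t = [] := by
    by_contra hbt
    have hlast := getLast?_markedConcat hash (L := List.ofFn u) (by simp)
    rw [hfac, wordPow_succ_right, show
      s ++ (wordPow (a ++ hash :: b) (n + 1) ++ (a ++ hash :: b)) ++ t =
        (s ++ wordPow (a ++ hash :: b) (n + 1) ++ a ++ [hash]) ++ (b ++ t) by simp,
      List.getLast?_append_of_ne_nil _ hbt] at hlast
    have := List.mem_of_getLast? hlast
    simp [hb, ht] at this
  obtain ⟨rfl, rfl⟩ := List.append_eq_nil_iff.1 hbt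
  have hlist : List.ofFn u = (s ++ a) :: List.replicate (n + 1) a := by
    refine markedConcat_injOn hash hfree ?_ ?_
    · simp [hs, ha]
    · rw [hfac, wordPow_succ, markedConcat_cons, wordPow_append_singleton]
      simp
  have hhead : u 0 = s ++ a := by
    simpa [List.ofFn_succ] using congrArg List.head? hlist
  have htail : ∀ i : Fin (n + 1), u i.succ = a := by
    rw [List.ofFn_succ] at hlist
    intro i
    exact List.eq_of_mem_replicate ((List.cons.inj hlist).2 ▸ (List.mem_ofFn' _ _).2 ⟨i, rfl⟩)
  refine ⟨a, ha, rfl, ?_, ⟨s, hhead.symm⟩, fun h => ?_⟩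
  · intro i hi
    obtain ⟨j, rfl⟩ := Fin.exists_succ_eq.2 (show i ≠ 0 by rintro rfl; simp at hi)
    exact htail j
  · rw [hlist, wordPow_append_singleton, ← hhead, List.replicate_succ]
    exact congrArg (fun x => markedConcat hash (x :: _)) h
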